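/- arXiv:2109.01029 — 2 statements merged into one kernel-verified Lean document; each statement's English description precedes it below -/
import Mathlib

section
/- Let ξ, η ∈ ℝ³ with ξ ≠ 0, η ≠ 0 and ξ − η ≠ 0. Then the second scaling derivative of the phase satisfies S_η² Φ(ξ,η) = S_η Φ(ξ,η) · [ 3 (η·(ξ−η))/‖ξ−η‖² + 2 ] − (σ̄(ξ,η) · ξ_h) / ‖ξ−η‖³. -/
/-- Euclidean norm on `ℝ³`. -/
noncomputable def nrm (ξ : Fin 3 → ℝ) : ℝ := Real.sqrt (ξ 0 ^ 2 + ξ 1 ^ 2 + ξ 2 ^ 2)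

/-- The dispersion relation `Λ(ξ) = ξ₃ / ‖ξ‖`. -/
noncomputable def Lam (ξ : Fin 3 → ℝ) : ℝ := ξ 2 / nrm ξ

/-- The phase `Φ(ξ,η) = Λ(ξ) + Λ(ξ−η) + ν Λ(η)`. -/
noncomputable def Phi (ν : ℝ) (ξ η : Fin 3 → ℝ) : ℝ := Lam ξ + Lam (ξ - η) + ν * Lam η

/-- Scaling vector field `S_η f = η · ∇_η f`. -/
noncomputable def SV (f : (Fin 3 → ℝ) → ℝ) : (Fin 3 → ℝ) → ℝ := fun η => fderiv ℝ f η η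

/-- Rotation vector field `Ω_η f = −η₂ ∂_{η₁} f + η₁ ∂_{η₂} f`. -/
noncomputable def OV (f : (Fin 3 → ℝ) → ℝ) : (Fin 3 → ℝ) → ℝ :=
  fun η => fderiv ℝ f η ![-(η 1), η 0, 0]

/-- The sum of squares of the coordinates of a nonzero vector of `ℝ³` is positive. -/
theorem sq_sum_pos {x : Fin 3 → ℝ} (hx : x ≠ 0) : 0 < x 0 ^ 2 + x 1 ^ 2 + x 2 ^ 2 := by
  by_contra! h
  refine hx (funext fun i => ?_)
  have h0 := sq_nonneg (x 0)
  have h1 := sq_nonneg (x 1)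
  have h2 := sq_nonneg (x 2)
  fin_cases i
  · exact sq_eq_zero_iff.1 (show x 0 ^ 2 = 0 by linarith)
  · exact sq_eq_zero_iff.1 (show x 1 ^ 2 = 0 by linarith)
  · exact sq_eq_zero_iff.1 (show x 2 ^ 2 = 0 by linarith)

theorem nrm_pos {x : Fin 3 → ℝ} (hx : x ≠ 0) : 0 < nrm x :=
  Real.sqrt_pos.2 (sq_sum_pos hx)

theorem nrm_sq (x : Fin 3 → ℝ) : nrm x ^ 2 = x 0 ^ 2 + x 1 ^ 2 + x 2 ^ 2 :=
  Real.sq_sqrt (by positivity)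

theorem differentiableAt_nrm {x : Fin 3 → ℝ} (hx : x ≠ 0) : DifferentiableAt ℝ nrm x := by
  unfold nrm
  exact DifferentiableAt.sqrt (by fun_prop) (sq_sum_pos hx).ne'

theorem differentiableAt_Lam {x : Fin 3 → ℝ} (hx : x ≠ 0) : DifferentiableAt ℝ Lam x := by
  have h := differentiableAt_nrm hx
  have hr := (nrm_pos hx).ne'
  unfold Lam
  fun_prop (disch := assumption)

theorem Lam_smul {t : ℝ} (ht : 0 < t) (x : Fin 3 → ℝ) : Lam (t • x) = Lam x := by
  have h : nrm (t • x) = t * nrm x := by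
    unfold nrm
    rw [← Real.sqrt_sq ht.le, ← Real.sqrt_mul (sq_nonneg t), Real.sqrt_sq ht.le]
    congr 1
    simp only [Pi.smul_apply, smul_eq_mul]
    ring
  unfold Lam
  rw [h, Pi.smul_apply, smul_eq_mul, mul_div_mul_left _ _ ht.ne']

/-- The scaling derivative is the derivative along dilations. -/
theorem SV_eq_of_hasDerivAt {f : (Fin 3 → ℝ) → ℝ} {η : Fin 3 → ℝ} {d : ℝ}
    (hf : DifferentiableAt ℝ f η) (hd : HasDerivAt (fun t : ℝ => f (t • η)) d 1) :
    SV f η = d := by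
  have hc : HasDerivAt (fun t : ℝ => t • η) η 1 := by
    simpa using (hasDerivAt_id (1 : ℝ)).smul_const η
  have hf' : HasFDerivAt f (fderiv ℝ f η) ((1 : ℝ) • η) := by simpa using hf.hasFDerivAt
  exact (hf'.comp_hasDerivAt (1 : ℝ) hc).unique hd

theorem hasDerivAt_sub_smul_apply (ξ η : Fin 3 → ℝ) (i : Fin 3) :
    HasDerivAt (fun t : ℝ => (ξ - t • η) i) (-(η i)) 1 := by
  simpa using ((hasDerivAt_id (1 : ℝ)).mul_const (η i)).const_sub (ξ i)

theorem hasDerivAt_nrm_sub_smul {ξ η : Fin 3 → ℝ} (h : ξ - η ≠ 0) :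
    HasDerivAt (fun t : ℝ => nrm (ξ - t • η))
      (-(η 0 * (ξ 0 - η 0) + η 1 * (ξ 1 - η 1) + η 2 * (ξ 2 - η 2)) / nrm (ξ - η)) 1 := by
  have hq := (((hasDerivAt_sub_smul_apply ξ η 0).fun_pow 2).fun_add
    ((hasDerivAt_sub_smul_apply ξ η 1).fun_pow 2)).fun_add
    ((hasDerivAt_sub_smul_apply ξ η 2).fun_pow 2)
  have hs := hq.sqrt (by simpa using (sq_sum_pos h).ne')
  have hr := (nrm_pos h).ne'
  unfold nrm at hr ⊢
  convert hs using 1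
  simp only [one_smul, Pi.sub_apply] at hr ⊢
  field_simp
  ring

/-- The numerator `σ̄(ξ,η) · (ξ_h − η_h)` of the first scaling derivative of the phase. -/
def scalingNumerator (ξ η : Fin 3 → ℝ) : ℝ :=
  (ξ 2 * η 0 - η 2 * ξ 0) * (ξ 0 - η 0) + (ξ 2 * η 1 - η 2 * ξ 1) * (ξ 1 - η 1)

theorem SV_Phi (ν : ℝ) {ξ η : Fin 3 → ℝ} (hη : η ≠ 0) (h : ξ - η ≠ 0) :
    SV (Phi ν ξ) η = scalingNumerator ξ η / nrm (ξ - η) ^ 3 := by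
  refine SV_eq_of_hasDerivAt ?_ ?_
  · unfold Phi
    have h1 : DifferentiableAt ℝ (fun x => Lam (ξ - x)) η :=
      (differentiableAt_Lam h).comp η (by fun_prop)
    exact (h1.const_add _).fun_add ((differentiableAt_Lam hη).const_mul ν)
  · have hr := (nrm_pos h).ne'
    have h1 := ((hasDerivAt_sub_smul_apply ξ η 2).fun_div (hasDerivAt_nrm_sub_smul h)
      (by simpa using hr)).const_add (Lam ξ)
    have h2 := h1.add_const (ν * Lam η)
    have h3 : (fun t : ℝ => Phi ν ξ (t • η)) =ᶠ[nhds 1]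
        fun t => Lam ξ + (ξ - t • η) 2 / nrm (ξ - t • η) + ν * Lam η := by
      filter_upwards [lt_mem_nhds zero_lt_one] with t ht
      rw [Phi, Lam_smul ht, Lam.eq_def (ξ - t • η)]
    refine (h2.congr_of_eventuallyEq h3).congr_deriv ?_
    have hn := nrm_sq (ξ - η)
    simp only [one_smul, Pi.sub_apply] at hn ⊢
    unfold scalingNumerator
    field_simp
    rw [hn]
    ring

theorem hasDerivAt_scalingNumerator_smul (ξ η : Fin 3 → ℝ) :
    HasDerivAt (fun t : ℝ => scalingNumerator ξ (t • η))
      (2 * scalingNumerator ξ η -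
        ((ξ 2 * η 0 - η 2 * ξ 0) * ξ 0 + (ξ 2 * η 1 - η 2 * ξ 1) * ξ 1)) 1 := by
  have hl (i : Fin 2) : HasDerivAt
      (fun t : ℝ => ξ 2 * (t • η) i.castSucc - (t • η) 2 * ξ i.castSucc)
      (ξ 2 * η i.castSucc - η 2 * ξ i.castSucc) 1 := by
    simpa using (((hasDerivAt_id (1 : ℝ)).mul_const (η i.castSucc)).const_mul (ξ 2)).fun_sub
      (((hasDerivAt_id (1 : ℝ)).mul_const (η 2)).mul_const (ξ i.castSucc))
  have hs := ((hl 0).fun_mul (hasDerivAt_sub_smul_apply ξ η 0)).fun_add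
    ((hl 1).fun_mul (hasDerivAt_sub_smul_apply ξ η 1))
  refine hs.congr_deriv ?_
  simp [scalingNumerator]
  ring

/-- `S_η²Φ = S_ηΦ·[3(η·(ξ−η))/‖ξ−η‖² + 2] − (σ̄(ξ,η)·ξ_h)/‖ξ−η‖³`. -/
theorem stmt5 (ν : ℝ) (hν : ν = 1 ∨ ν = -1) (ξ η : Fin 3 → ℝ)
    (hξ : ξ ≠ 0) (hη : η ≠ 0) (hξη : ξ - η ≠ 0) :
    SV (SV (Phi ν ξ)) η =
      SV (Phi ν ξ) η *
        (3 * ((η 0 * (ξ 0 - η 0) + η 1 * (ξ 1 - η 1) + η 2 * (ξ 2 - η 2)) / nrm (ξ - η) ^ 2) + 2) -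
      ((ξ 2 * η 0 - η 2 * ξ 0) * ξ 0 + (ξ 2 * η 1 - η 2 * ξ 1) * ξ 1) / nrm (ξ - η) ^ 3 := by
  have hr := (nrm_pos hξη).ne'
  have hev : SV (Phi ν ξ) =ᶠ[nhds η] fun x => scalingNumerator ξ x / nrm (ξ - x) ^ 3 := by
    have hc : ContinuousAt (fun x : Fin 3 → ℝ => ξ - x) η := by fun_prop
    filter_upwards [isOpen_ne.mem_nhds hη, hc.eventually_ne hξη] with x hx hx'
    exact SV_Phi ν hx hx'
  have hdiff : DifferentiableAt ℝ (fun x => scalingNumerator ξ x / nrm (ξ - x) ^ 3) η := by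
    have h1 : DifferentiableAt ℝ (fun x => nrm (ξ - x)) η :=
      (differentiableAt_nrm hξη).comp η (by fun_prop)
    have hr3 := pow_ne_zero 3 hr
    unfold scalingNumerator
    fun_prop (disch := assumption)
  have hd := (hasDerivAt_scalingNumerator_smul ξ η).fun_div
    ((hasDerivAt_nrm_sub_smul hξη).fun_pow 3) (by simpa using hr)
  have hSV : SV (SV (Phi ν ξ)) η = SV (fun x => scalingNumerator ξ x / nrm (ξ - x) ^ 3) η := by
    rw [SV, SV, hev.fderiv_eq]
  rw [hSV, SV_eq_of_hasDerivAt hdiff hd, SV_Phi ν hη hξη]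
  simp only [one_smul]
  field_simp
  ring
end

section
/- Let ξ, η ∈ ℝ³ with ξ ≠ 0, η ≠ 0 and ξ − η ≠ 0. Then the second rotation derivative of the phase satisfies Ω_η² Φ(ξ,η) = 3 · Ω_η Φ(ξ,η) · (η₁ξ₂ − η₂ξ₁)/‖ξ−η‖² − Λ(ξ−η) · (η_h·ξ_h)/‖ξ−η‖². -/
open ContinuousLinearMap in
/-- The differential `ζ · ∇` of `‖ζ‖² / 2`, as a continuous linear functional on `ℝ³`. -/
noncomputable def dotCLM (ζ : Fin 3 → ℝ) : (Fin 3 → ℝ) →L[ℝ] ℝ :=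
  ζ 0 • proj (R := ℝ) (φ := fun _ : Fin 3 => ℝ) 0 + ζ 1 • proj (R := ℝ) (φ := fun _ : Fin 3 => ℝ) 1 +
    ζ 2 • proj (R := ℝ) (φ := fun _ : Fin 3 => ℝ) 2

theorem dotCLM_apply (ζ v : Fin 3 → ℝ) :
    dotCLM ζ v = ζ 0 * v 0 + ζ 1 * v 1 + ζ 2 * v 2 := by
  simp [dotCLM]

theorem sum_sq_pos {ζ : Fin 3 → ℝ} (h : ζ ≠ 0) : 0 < ζ 0 ^ 2 + ζ 1 ^ 2 + ζ 2 ^ 2 := by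
  obtain ⟨i, hi⟩ := Function.ne_iff.mp h
  have hi' : ζ i ≠ 0 := hi
  fin_cases i <;> simp only [Fin.zero_eta, Fin.mk_one, Fin.reduceFinMk] at hi' <;> positivity

theorem nrm_pos_s6 {ζ : Fin 3 → ℝ} (h : ζ ≠ 0) : 0 < nrm ζ :=
  Real.sqrt_pos.mpr (sum_sq_pos h)

theorem hasFDerivAt_coord (i : Fin 3) (ζ : Fin 3 → ℝ) :
    HasFDerivAt (fun x : Fin 3 → ℝ => x i)
      (ContinuousLinearMap.proj (R := ℝ) (φ := fun _ : Fin 3 => ℝ) i) ζ :=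
  hasFDerivAt_apply i ζ

theorem hasFDerivAt_nrm {ζ : Fin 3 → ℝ} (h : ζ ≠ 0) :
    HasFDerivAt nrm ((nrm ζ)⁻¹ • dotCLM ζ) ζ := by
  have hs := ((((hasFDerivAt_coord 0 ζ).pow 2).add ((hasFDerivAt_coord 1 ζ).pow 2)).add
    ((hasFDerivAt_coord 2 ζ).pow 2)).sqrt (sum_sq_pos h).ne'
  refine hs.congr_fderiv ?_
  have hn := (nrm_pos_s6 h).ne'
  refine ContinuousLinearMap.ext fun v => ?_
  change 1 / (2 * nrm ζ) * (_ : (Fin 3 → ℝ) →L[ℝ] ℝ) v = (nrm ζ)⁻¹ * dotCLM ζ v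
  rw [dotCLM_apply]
  simp
  field_simp

theorem hasFDerivAt_Lam {ζ : Fin 3 → ℝ} (h : ζ ≠ 0) :
    HasFDerivAt Lam ((nrm ζ)⁻¹ • ContinuousLinearMap.proj (R := ℝ) (φ := fun _ : Fin 3 => ℝ) 2 -
      (ζ 2 / nrm ζ ^ 3) • dotCLM ζ) ζ := by
  have hn := (nrm_pos_s6 h).ne'
  have hinv := (hasDerivAt_inv hn).comp_hasFDerivAt ζ (hasFDerivAt_nrm h)
  refine ((hasFDerivAt_coord 2 ζ).mul hinv).congr_fderiv ?_
  refine ContinuousLinearMap.ext fun v => ?_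
  simp
  field_simp
  ring

theorem hasFDerivAt_const_sub (ξ η : Fin 3 → ℝ) :
    HasFDerivAt (fun x => ξ - x) (-ContinuousLinearMap.id ℝ (Fin 3 → ℝ)) η :=
  (hasFDerivAt_id η).const_sub ξ

theorem OV_Phi (ν : ℝ) {ξ η : Fin 3 → ℝ} (hη : η ≠ 0) (hξη : ξ - η ≠ 0) :
    OV (Phi ν ξ) η =
      (η 0 * ξ 1 - η 1 * ξ 0) * ((ξ - η) 2 * (nrm (ξ - η) ^ 3)⁻¹) := by
  have h : HasFDerivAt (Phi ν ξ) _ η :=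
    ((((hasFDerivAt_Lam hξη).comp η (hasFDerivAt_const_sub ξ η)).const_add (Lam ξ)).add
      ((hasFDerivAt_Lam hη).const_mul ν))
  rw [OV, h.fderiv]
  simp [dotCLM_apply]
  ring

/-- `Ω_η²Φ = 3·Ω_ηΦ·(η₁ξ₂−η₂ξ₁)/‖ξ−η‖² − Λ(ξ−η)·(η_h·ξ_h)/‖ξ−η‖²`. -/
theorem stmt6 (ν : ℝ) (hν : ν = 1 ∨ ν = -1) (ξ η : Fin 3 → ℝ)
    (hξ : ξ ≠ 0) (hη : η ≠ 0) (hξη : ξ - η ≠ 0) :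
    OV (OV (Phi ν ξ)) η =
      3 * OV (Phi ν ξ) η * ((η 0 * ξ 1 - η 1 * ξ 0) / nrm (ξ - η) ^ 2) -
        Lam (ξ - η) * ((η 0 * ξ 0 + η 1 * ξ 1) / nrm (ξ - η) ^ 2) := by
  have hev : OV (Phi ν ξ) =ᶠ[nhds η] fun x =>
      (x 0 * ξ 1 - x 1 * ξ 0) * ((ξ - x) 2 * (nrm (ξ - x) ^ 3)⁻¹) := by
    filter_upwards [isOpen_ne.mem_nhds hη,
      (continuous_const.sub continuous_id).continuousAt.eventually_ne hξη] with x hx hξx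
    exact OV_Phi ν hx hξx
  have hn := (nrm_pos_s6 hξη).ne'
  have hsub := hasFDerivAt_const_sub ξ η
  have hinv := (hasDerivAt_inv (pow_ne_zero 3 hn)).comp_hasFDerivAt η
    (((hasFDerivAt_nrm hξη).comp η hsub).pow 3)
  have hd := (((hasFDerivAt_coord 0 η).mul_const (ξ 1)).sub
    ((hasFDerivAt_coord 1 η).mul_const (ξ 0))).mul
      (((hasFDerivAt_coord 2 (ξ - η)).comp η hsub).mul hinv)
  rw [OV_Phi ν hη hξη, OV, hev.fderiv_eq]
  erw [hd.fderiv]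
  simp [dotCLM_apply, Lam]
  field_simp
  ring
end
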